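/- Let φ : ℝ⁴ → ℝ⁴ be a bijection such that for every pair r₁, r₂ ∈ ℝ⁴ one has ⟨r₁ − r₂, r₁ − r₂⟩ = 0 if and only if ⟨φ(r₁) − φ(r₂), φ(r₁) − φ(r₂)⟩ = 0. Then there exist a real number c > 0, a Lorentz matrix Q, and a vector a ∈ ℝ⁴ such that φ(r) = c·(Q r) + a for every r ∈ ℝ⁴. -/

import Mathlib

open Matrix

noncomputable section

/-- The Lorentz–Minkowski bilinear form on `ℝ⁴`:
`⟨r, s⟩ = −x₁x₂ − y₁y₂ − z₁z₂ + t₁t₂`. -/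
def mink (r s : Fin 4 → ℝ) : ℝ :=
  -(r 0 * s 0) - r 1 * s 1 - r 2 * s 2 + r 3 * s 3

/-- The matrix `M = diag(−1, −1, −1, 1)`. -/
def minkM : Matrix (Fin 4) (Fin 4) ℝ :=
  Matrix.diagonal ![-1, -1, -1, 1]

/-- A Lorentz matrix: a real `4×4` matrix `Q` with `Qᵀ M Q = M`. -/
def IsLorentz (Q : Matrix (Fin 4) (Fin 4) ℝ) : Prop :=
  Qᵀ * minkM * Q = minkM

lemma mink_comm (r s : Fin 4 → ℝ) : mink r s = mink s r := by
  simp only [mink]; ring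

lemma mink_add_left (r s u : Fin 4 → ℝ) : mink (r + s) u = mink r u + mink s u := by
  simp only [mink, Pi.add_apply]; ring

lemma mink_add_right (r s u : Fin 4 → ℝ) : mink r (s + u) = mink r s + mink r u := by
  simp only [mink, Pi.add_apply]; ring

lemma mink_sub_left (r s u : Fin 4 → ℝ) : mink (r - s) u = mink r u - mink s u := by
  simp only [mink, Pi.sub_apply]; ring

lemma mink_sub_right (r s u : Fin 4 → ℝ) : mink r (s - u) = mink r s - mink r u := by
  simp only [mink, Pi.sub_apply]; ring

lemma mink_smul_left (c : ℝ) (r s : Fin 4 → ℝ) : mink (c • r) s = c * mink r s := by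
  simp only [mink, Pi.smul_apply, smul_eq_mul]; ring

lemma mink_smul_right (c : ℝ) (r s : Fin 4 → ℝ) : mink r (c • s) = c * mink r s := by
  simp only [mink, Pi.smul_apply, smul_eq_mul]; ring

lemma mink_zero_left (r : Fin 4 → ℝ) : mink 0 r = 0 := by
  simp [mink]

/-- A nonzero null vector has nonzero time component. -/
lemma time_ne_zero {v : Fin 4 → ℝ} (hv : mink v v = 0) (hv0 : v ≠ 0) : v 3 ≠ 0 := by
  intro h3
  apply hv0
  simp only [mink, h3] at hv
  ext i
  fin_cases i <;> simp only [Fin.zero_eta, Fin.mk_one, Fin.reduceFinMk, Pi.zero_apply]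
  · nlinarith [sq_nonneg (v 0), sq_nonneg (v 1), sq_nonneg (v 2)]
  · nlinarith [sq_nonneg (v 0), sq_nonneg (v 1), sq_nonneg (v 2)]
  · nlinarith [sq_nonneg (v 0), sq_nonneg (v 1), sq_nonneg (v 2)]
  · exact h3

/-- Orthogonal null vectors are parallel. -/
lemma exists_smul_of_null_of_orthogonal {v z : Fin 4 → ℝ} (hv : mink v v = 0) (hv0 : v ≠ 0)
    (hz : mink z z = 0) (hvz : mink v z = 0) : ∃ t : ℝ, z = t • v := by
  have h3 := time_ne_zero hv hv0
  refine ⟨z 3 / v 3, ?_⟩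
  by_contra hne
  refine time_ne_zero (v := z - (z 3 / v 3) • v) ?_ (sub_ne_zero.2 hne) ?_
  · simp only [mink_sub_left, mink_sub_right, mink_smul_left, mink_smul_right, hv, hz, hvz,
      mink_comm z v]
    ring
  · simp [h3]

/-- The points lightlike to both ends of a null segment are those of the line through it. -/
lemma null_and_null_sub_iff {v z : Fin 4 → ℝ} (hv : mink v v = 0) (hv0 : v ≠ 0) :
    (mink z z = 0 ∧ mink (z - v) (z - v) = 0) ↔ ∃ t : ℝ, z = t • v := by
  constructor
  · rintro ⟨h1, h2⟩
    refine exists_smul_of_null_of_orthogonal hv hv0 h1 ?_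
    simp only [mink_sub_left, mink_sub_right, hv, h1, mink_comm z v] at h2
    linarith
  · rintro ⟨t, rfl⟩
    simp [mink_sub_left, mink_sub_right, mink_smul_left, mink_smul_right, hv]

/-- The null hyperplane through `x` and `y` described by lightlikeness alone. -/
def InNullHyperplane (x y z : Fin 4 → ℝ) : Prop :=
  (mink (z - x) (z - x) = 0 ∧ mink (z - y) (z - y) = 0) ∨
    ∀ p, mink (p - x) (p - x) = 0 → mink (p - y) (p - y) = 0 → mink (z - p) (z - p) ≠ 0

lemma inNullHyperplane_iff {x y z : Fin 4 → ℝ} (hv : mink (y - x) (y - x) = 0) (hxy : y ≠ x) :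
    InNullHyperplane x y z ↔ mink (y - x) (z - x) = 0 := by
  obtain ⟨v, rfl⟩ : ∃ v, y = x + v := ⟨y - x, by abel⟩
  obtain ⟨u, rfl⟩ : ∃ u, z = x + u := ⟨z - x, by abel⟩
  have hv0 : v ≠ 0 := by rintro rfl; simp at hxy
  simp only [InNullHyperplane, add_sub_cancel_left, add_sub_add_left_eq_sub] at hv ⊢
  rw [null_and_null_sub_iff hv hv0]
  constructor
  · rintro (⟨t, rfl⟩ | hp)
    · rw [mink_smul_right, hv, mul_zero]
    · by_contra hne
      have h1 := fun t : ℝ => hp (x + t • v)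
      simp only [add_sub_cancel_left, add_sub_add_left_eq_sub] at h1
      refine h1 (mink u u / (2 * mink v u)) ?_ ?_ ?_
      · simp [mink_smul_left, mink_smul_right, hv]
      · simp [mink_sub_left, mink_sub_right, mink_smul_left, mink_smul_right, hv]
      · simp only [mink_sub_left, mink_sub_right, mink_smul_left, mink_smul_right, hv,
          mink_comm u v]
        field_simp
        ring
  · intro hvu
    by_cases hu : mink u u = 0
    · exact Or.inl (exists_smul_of_null_of_orthogonal hv hv0 hu hvu)
    · right
      intro p hp1 hp2 hp3
      obtain ⟨w, rfl⟩ : ∃ w, p = x + w := ⟨p - x, by abel⟩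
      simp only [add_sub_cancel_left, add_sub_add_left_eq_sub] at hp1 hp2 hp3
      obtain ⟨t, rfl⟩ := (null_and_null_sub_iff hv hv0).1 ⟨hp1, hp2⟩
      simp [mink_sub_left, mink_sub_right, mink_smul_left, mink_smul_right, hv, hvu,
        mink_comm u v] at hp3
      exact hu hp3

/-- Null vectors not orthogonal to a fixed nonzero null vector generate spacetime additively. -/
lemma addSubgroup_eq_top_of_null_mem (G : AddSubgroup (Fin 4 → ℝ)) {w : Fin 4 → ℝ}
    (hw : mink w w = 0) (hw0 : w ≠ 0)
    (hG : ∀ v, mink v v = 0 → mink v w ≠ 0 → v ∈ G) : G = ⊤ := by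
  have h3 := time_ne_zero hw hw0
  have hmem : ∀ (v : Fin 4 → ℝ), mink v v = 0 → mink v w ≠ 0 → ∀ s : ℝ, s • v ∈ G := by
    intro v hv hvw s
    by_cases hs : s = 0
    · simp [hs, G.zero_mem]
    · refine hG _ ?_ ?_
      · simp [mink_smul_left, mink_smul_right, hv]
      · simpa [mink_smul_left, hs] using hvw
  have ht : ∀ s : ℝ, s • ![0, 0, 0, 1] ∈ G := by
    intro s
    by_cases h0 : w 3 - w 0 ≠ 0 ∧ w 3 + w 0 ≠ 0
    · have h1 := G.add_mem
        (hmem ![1, 0, 0, 1] (by simp [mink])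
          (by intro hc; apply h0.1; simp [mink] at hc; linarith) (s / 2))
        (hmem ![-1, 0, 0, 1] (by simp [mink])
          (by intro hc; apply h0.2; simp [mink] at hc; linarith) (s / 2))
      convert h1 using 1
      ext i; fin_cases i <;> simp
    · have h00 : w 0 ^ 2 = w 3 ^ 2 := by
        by_cases h4 : w 3 - w 0 = 0
        · rw [sub_eq_zero.1 h4]
        · have h5 : w 3 + w 0 = 0 := by tauto
          linear_combination (w 0 - w 3) * h5
      have h11 : w 1 = 0 := by
        simp only [mink] at hw
        nlinarith [sq_nonneg (w 1), sq_nonneg (w 2)]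
      have h1 := G.add_mem
        (hmem ![0, 1, 0, 1] (by simp [mink])
          (by simp [mink, h11, h3]) (s / 2))
        (hmem ![0, -1, 0, 1] (by simp [mink])
          (by simp [mink, h11, h3]) (s / 2))
      convert h1 using 1
      ext i; fin_cases i <;> simp
  obtain ⟨e, heG, he, he'⟩ : ∃ e : Fin 4 → ℝ, (∀ s : ℝ, s • e ∈ G) ∧
      (∀ v, mink e v = v 3) ∧ ∀ v, mink v e = v 3 :=
    ⟨![0, 0, 0, 1], ht, fun v => by simp [mink], fun v => by simp [mink]⟩
  have hsp : ∀ (u : Fin 4 → ℝ), u 3 = 0 → mink u u = -1 → ∀ s : ℝ, s • u ∈ G := by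
    intro u hu3 hu s
    have he3 : e 3 = 1 := by
      have h1 : mink ![0, 0, 0, 1] e = e 3 := by simp [mink]
      rw [← h1, he']
      simp
    by_cases h1 : mink u w + w 3 = 0
    · have h2 := hmem (u - e)
        (by simp [mink_sub_left, mink_sub_right, he, he', hu, hu3, he3])
        (by
          simp only [mink_sub_left, he]
          intro h2
          apply h3
          linarith) s
      convert G.add_mem h2 (heG s) using 1
      rw [smul_sub, sub_add_cancel]
    · have h2 := hmem (u + e)
        (by simp [mink_add_left, mink_add_right, he, he', hu, hu3, he3])
        (by simpa only [mink_add_left, he] using h1) s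
      convert G.sub_mem h2 (heG s) using 1
      rw [smul_add, add_sub_cancel_right]
  rw [eq_top_iff]
  intro y _
  convert G.add_mem (G.add_mem (G.add_mem
    (hsp ![1, 0, 0, 0] (by simp) (by simp [mink]) (y 0))
    (hsp ![0, 1, 0, 0] (by simp) (by simp [mink]) (y 1)))
    (hsp ![0, 0, 1, 0] (by simp) (by simp [mink]) (y 2))) (ht (y 3)) using 1
  ext i; fin_cases i <;> simp

/-- Every nonzero null vector spans, with another null vector, a timelike plane, and that plane has
an orthogonal spacelike vector. -/
lemma exists_null_and_orthogonal_spacelike {v : Fin 4 → ℝ} (hv : mink v v = 0) (hv0 : v ≠ 0) :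
    ∃ w u : Fin 4 → ℝ, mink w w = 0 ∧ 0 < mink v w ∧ mink v u = 0 ∧ mink w u = 0 ∧
      mink u u < 0 := by
  have h3 := time_ne_zero hv hv0
  have h33 : 0 < v 3 * v 3 := mul_self_pos.2 h3
  obtain ⟨a, b, hab, hpos⟩ : ∃ a b : ℝ, v 0 * a + v 1 * b = 0 ∧ 0 < a * a + b * b := by
    by_cases h0 : v 0 = 0
    · exact ⟨1, 0, by simp [h0], by norm_num⟩
    · refine ⟨-v 1, v 0, by ring, ?_⟩
      have h00 : 0 < v 0 * v 0 := mul_self_pos.2 h0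
      nlinarith [mul_self_nonneg (v 1)]
  simp only [mink] at hv
  refine ⟨![-v 0, -v 1, -v 2, v 3], ![a, b, 0, 0], ?_, ?_, ?_, ?_, ?_⟩ <;> simp [mink] <;>
    linarith

/-- A bijection of spacetime preserving lightlikeness in both directions. -/
structure PreservesLightlike (φ : (Fin 4 → ℝ) → (Fin 4 → ℝ)) : Prop where
  bijective : Function.Bijective φ
  lightlike_iff : ∀ r₁ r₂ : Fin 4 → ℝ,
    mink (r₁ - r₂) (r₁ - r₂) = 0 ↔ mink (φ r₁ - φ r₂) (φ r₁ - φ r₂) = 0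

namespace PreservesLightlike

variable {φ : (Fin 4 → ℝ) → (Fin 4 → ℝ)}

lemma inNullHyperplane_iff_map (hφ : PreservesLightlike φ) (x y z : Fin 4 → ℝ) :
    InNullHyperplane x y z ↔ InNullHyperplane (φ x) (φ y) (φ z) := by
  unfold InNullHyperplane
  rw [hφ.bijective.surjective.forall (p := fun p => mink (p - φ x) (p - φ x) = 0 → _)]
  simp only [ne_eq, ← hφ.lightlike_iff]

/-- The increment of a lightlike-preserving map along a null vector is null. -/
lemma null_increment (hφ : PreservesLightlike φ) {v : Fin 4 → ℝ} (hv : mink v v = 0)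
    (x : Fin 4 → ℝ) : mink (φ (x + v) - φ x) (φ (x + v) - φ x) = 0 := by
  rw [← hφ.lightlike_iff]
  simpa using hv

lemma increment_ne_zero (hφ : PreservesLightlike φ) {v : Fin 4 → ℝ} (hv0 : v ≠ 0)
    (x : Fin 4 → ℝ) : φ (x + v) - φ x ≠ 0 := by
  rw [sub_ne_zero]
  intro hc
  exact hv0 (by simpa using hφ.bijective.injective hc)

lemma orthogonal_iff_map (hφ : PreservesLightlike φ) {v : Fin 4 → ℝ} (hv : mink v v = 0)
    (hv0 : v ≠ 0) (x z : Fin 4 → ℝ) :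
    mink v (z - x) = 0 ↔ mink (φ (x + v) - φ x) (φ z - φ x) = 0 := by
  have h1 := inNullHyperplane_iff (x := x) (y := x + v) (z := z) (by simpa using hv)
    (by simpa using hv0)
  have h2 := inNullHyperplane_iff (z := φ z) (hφ.null_increment hv x)
    (sub_ne_zero.1 (hφ.increment_ne_zero hv0 x))
  rw [← h2, ← hφ.inNullHyperplane_iff_map, h1, add_sub_cancel_left]

/-- Parallel null lines are mapped to parallel null lines. -/
lemma exists_increment_eq_smul (hφ : PreservesLightlike φ) {v : Fin 4 → ℝ} (hv : mink v v = 0)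
    (hv0 : v ≠ 0) (x y : Fin 4 → ℝ) :
    ∃ t : ℝ, φ (y + v) - φ y = t • (φ (x + v) - φ x) := by
  refine exists_smul_of_null_of_orthogonal (hφ.null_increment hv x) (hφ.increment_ne_zero hv0 x)
    (hφ.null_increment hv y) ?_
  have hx := hφ.orthogonal_iff_map hv hv0 x
  have hy := hφ.orthogonal_iff_map hv hv0 y
  have ha := hφ.null_increment hv x
  have hb := hφ.null_increment hv y
  set a := φ (x + v) - φ x
  set b := φ (y + v) - φ y
  by_contra hab
  have hsol : ∀ α β : ℝ, ∃ z, mink a (φ z) = α ∧ mink b (φ z) = β := by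
    intro α β
    obtain ⟨z, hz⟩ := hφ.bijective.surjective ((β / mink a b) • a + (α / mink a b) • b)
    refine ⟨z, ?_, ?_⟩ <;>
    · rw [hz]
      simp only [mink_add_right, mink_smul_right, ha, hb, mink_comm b a]
      field_simp
      ring
  simp only [mink_sub_right, sub_eq_zero] at hx hy
  by_cases hxy : mink v x = mink v y
  · obtain ⟨z, hz1, hz2⟩ := hsol (mink a (φ x)) (mink b (φ y) + 1)
    have h1 := (hy z).1 (((hx z).2 hz1).trans hxy)
    linarith
  · obtain ⟨z, hz1, hz2⟩ := hsol (mink a (φ x)) (mink b (φ y))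
    exact hxy (((hx z).2 hz1).symm.trans ((hy z).2 hz2))

/-- The image of a null parallelogram is a parallelogram. -/
lemma increment_add_eq (hφ : PreservesLightlike φ) {v w : Fin 4 → ℝ} (hv : mink v v = 0)
    (hw : mink w w = 0) (hvw : mink v w ≠ 0) (x : Fin 4 → ℝ) :
    φ (x + v + w) - φ (x + v) = φ (x + w) - φ x := by
  have hv0 : v ≠ 0 := by rintro rfl; simp [mink_zero_left] at hvw
  have hw0 : w ≠ 0 := by rintro rfl; simp [mink_comm v, mink_zero_left] at hvw
  obtain ⟨α, hα⟩ := hφ.exists_increment_eq_smul hv hv0 x (x + w)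
  obtain ⟨β, hβ⟩ := hφ.exists_increment_eq_smul hw hw0 x (x + v)
  have ha := hφ.null_increment hv x
  have hb := hφ.null_increment hw x
  have hab : mink (φ (x + v) - φ x) (φ (x + w) - φ x) ≠ 0 := by
    intro hab
    have h1 := (hφ.lightlike_iff (x + v) (x + w)).2 (by
      rw [← sub_sub_sub_cancel_right _ _ (φ x), mink_sub_left, mink_sub_right _ (_ - _),
        mink_sub_right _ (_ - _), ha, hb, mink_comm (φ (x + w) - φ x), hab]
      ring)
    simp only [add_sub_add_left_eq_sub, mink_sub_left, mink_sub_right, hv, hw, mink_comm w v]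
      at h1
    apply hvw
    linarith
  rw [hβ]
  set a := φ (x + v) - φ x with ha'
  set b := φ (x + w) - φ x with hb'
  have hsum : a + β • b = b + α • a := by
    rw [← hα, ← hβ, add_right_comm x w v, ha', hb']
    abel
  have h2 := congrArg (mink a) hsum
  simp only [mink_add_right, mink_smul_right, ha] at h2
  have h3 : β = 1 := mul_right_cancel₀ hab (by linarith)
  rw [h3, one_smul]

lemma map_add_null (hφ : PreservesLightlike φ) (h0 : φ 0 = 0) {w : Fin 4 → ℝ}
    (hw : mink w w = 0) (x : Fin 4 → ℝ) : φ (x + w) = φ x + φ w := by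
  by_cases hw0 : w = 0
  · simp [hw0, h0]
  let G : AddSubgroup (Fin 4 → ℝ) :=
    { carrier := {v | ∀ x, φ (x + v + w) - φ (x + v) = φ (x + w) - φ x}
      zero_mem' := by simp
      add_mem' := by
        intro u v hu hv x
        rw [← add_assoc, hv, hu]
      neg_mem' := by
        intro v hv x
        have h1 := hv (x + -v)
        rw [neg_add_cancel_right] at h1
        exact h1.symm }
  have hG : G = ⊤ := addSubgroup_eq_top_of_null_mem G hw hw0
    fun v hv hvw x => hφ.increment_add_eq hv hw hvw x
  have hx : x ∈ G := hG ▸ AddSubgroup.mem_top x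
  have h1 := hx 0
  simp only [zero_add, h0, sub_zero] at h1
  rw [← h1]
  abel

/-- A lightlike-preserving bijection fixing the origin is additive. -/
lemma map_add (hφ : PreservesLightlike φ) (h0 : φ 0 = 0) (x y : Fin 4 → ℝ) :
    φ (x + y) = φ x + φ y := by
  let G : AddSubgroup (Fin 4 → ℝ) :=
    { carrier := {w | ∀ x, φ (x + w) = φ x + φ w}
      zero_mem' := by simp [h0]
      add_mem' := by
        intro u v hu hv x
        rw [← add_assoc, hv, hu, hv u, add_assoc]
      neg_mem' := by
        intro v hv x
        have h1 := hv (x + -v)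
        have h2 := hv (-v)
        rw [neg_add_cancel_right] at h1
        rw [neg_add_cancel, h0] at h2
        rw [h1, add_assoc, add_comm (φ v), ← h2, add_zero] }
  have hG : G = ⊤ := addSubgroup_eq_top_of_null_mem G (w := ![1, 0, 0, 1]) (by simp [mink])
    (fun hc => by simpa using congrFun hc 0)
    fun v hv _ x => hφ.map_add_null h0 hv x
  have hy : y ∈ G := hG ▸ AddSubgroup.mem_top y
  exact hy x

lemma map_neg (hφ : PreservesLightlike φ) (h0 : φ 0 = 0) (x : Fin 4 → ℝ) : φ (-x) = -φ x := by
  have h1 := hφ.map_add h0 (-x) x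
  rw [neg_add_cancel, h0] at h1
  exact eq_neg_of_add_eq_zero_left h1.symm

lemma null_iff_map (hφ : PreservesLightlike φ) (h0 : φ 0 = 0) (x : Fin 4 → ℝ) :
    mink x x = 0 ↔ mink (φ x) (φ x) = 0 := by
  simpa [h0] using hφ.lightlike_iff x 0

/-- Null lines through the origin are mapped into null lines through the origin. -/
lemma exists_map_smul_eq (hφ : PreservesLightlike φ) (h0 : φ 0 = 0) {v : Fin 4 → ℝ}
    (hv : mink v v = 0) (hv0 : v ≠ 0) : ∃ f : ℝ → ℝ, ∀ t, φ (t • v) = f t • φ v := by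
  have hne : φ v ≠ 0 := by simpa [h0] using hφ.increment_ne_zero hv0 0
  have h1 : ∀ t : ℝ, ∃ s : ℝ, φ (t • v) = s • φ v := by
    intro t
    rw [← null_and_null_sub_iff ((hφ.null_iff_map h0 v).1 hv) hne, ← hφ.null_iff_map h0,
      ← hφ.lightlike_iff, null_and_null_sub_iff hv hv0]
    exact ⟨t, rfl⟩
  choose f hf using h1
  exact ⟨f, hf⟩

/-- Along a null line a lightlike-preserving bijection is homogeneous: the scaling function is a
ring endomorphism of the reals. -/
lemma map_smul_null (hφ : PreservesLightlike φ) (h0 : φ 0 = 0) {v : Fin 4 → ℝ}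
    (hv : mink v v = 0) (t : ℝ) : φ (t • v) = t • φ v := by
  by_cases hv0 : v = 0
  · simp [hv0, h0]
  obtain ⟨w, u, hw, hvw, hvu, hwu, hu⟩ := exists_null_and_orthogonal_spacelike hv hv0
  have hw0 : w ≠ 0 := by rintro rfl; simp [mink_comm v, mink_zero_left] at hvw
  obtain ⟨f, hf⟩ := hφ.exists_map_smul_eq h0 hv hv0
  obtain ⟨g, hg⟩ := hφ.exists_map_smul_eq h0 hw hw0
  have ha := (hφ.null_iff_map h0 v).1 hv
  have hb := (hφ.null_iff_map h0 w).1 hw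
  have hne : ∀ {x}, x ≠ 0 → φ x ≠ 0 := fun {x} hx => by
    simpa [h0] using hφ.increment_ne_zero hx 0
  have hab : mink (φ v) (φ w) ≠ 0 := by
    intro hab
    have h1 := (hφ.null_iff_map h0 (v + w)).2 (by
      simp [hφ.map_add h0, mink_add_left, mink_add_right, ha, hb, hab, mink_comm (φ w)])
    simp only [mink_add_left, mink_add_right, hv, hw, mink_comm w v] at h1
    linarith
  have hf1 : f 1 = 1 := by
    have h1 := hf 1
    rw [one_smul] at h1
    exact smul_left_injective ℝ (hne hv0) (by simpa using h1.symm)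
  have hg1 : g 1 = 1 := by
    have h1 := hg 1
    rw [one_smul] at h1
    exact smul_left_injective ℝ (hne hw0) (by simpa using h1.symm)
  have hfadd : ∀ x y, f (x + y) = f x + f y := by
    intro x y
    refine smul_left_injective ℝ (hne hv0) ?_
    simp only [add_smul, ← hf, hφ.map_add h0]
  have hconst : ∀ k : ℝ, 0 < k → ∃ C : ℝ, ∀ x y : ℝ, x * y = k → f x * g y = C := by
    intro k hk
    obtain ⟨u', hvu', hwu', hu'⟩ : ∃ u', mink v u' = 0 ∧ mink w u' = 0 ∧
        mink u' u' = -(2 * k * mink v w) := by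
      refine ⟨√(2 * k * mink v w / -mink u u) • u, ?_, ?_, ?_⟩
      · rw [mink_smul_right, hvu, mul_zero]
      · rw [mink_smul_right, hwu, mul_zero]
      · rw [mink_smul_right, mink_smul_left, ← mul_assoc, Real.mul_self_sqrt]
        · have h1 : mink u u ≠ 0 := hu.ne
          field_simp
        · have h1 : 0 < -mink u u := by linarith
          positivity
    refine ⟨-mink (φ u') (φ u') / (2 * mink (φ v) (φ w)), fun x y hxy => ?_⟩
    have h1 := (hφ.null_iff_map h0 (u' + (x • v + y • w))).1 (by
      simp only [mink_add_left, mink_add_right, mink_smul_left, mink_smul_right, hv, hw, hu',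
        mink_comm w v, hvu', hwu', mink_comm u' v, mink_comm u' w]
      linear_combination 2 * mink v w * hxy)
    have h2 := (hφ.null_iff_map h0 (-u' + (x • v + y • w))).1 (by
      rw [← neg_one_smul ℝ u']
      simp only [mink_add_left, mink_add_right, mink_smul_left, mink_smul_right, hv, hw, hu',
        mink_comm w v, hvu', hwu', mink_comm u' v, mink_comm u' w]
      linear_combination 2 * mink v w * hxy)
    simp only [hφ.map_add h0, hφ.map_neg h0, hf, hg] at h1 h2
    rw [← neg_one_smul ℝ (φ u')] at h2
    simp only [mink_add_left, mink_add_right, mink_smul_left, mink_smul_right, ha, hb,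
      mink_comm (φ w) (φ v), mink_comm (φ u') (φ v), mink_comm (φ u') (φ w)] at h1 h2
    field_simp
    linear_combination (h1 + h2) / 2
  have hfg : ∀ k, 0 < k → g k = f k := by
    intro k hk
    obtain ⟨C, hC⟩ := hconst k hk
    have h1 := hC 1 k (by ring)
    have h2 := hC k 1 (by ring)
    rw [hf1] at h1
    rw [hg1] at h2
    linarith
  have hpos : ∀ x, 0 < x → f (x * x) = f x * f x := by
    intro x hx
    obtain ⟨C, hC⟩ := hconst (x * x) (by positivity)
    have h1 := hC x x rfl
    have h2 := hC (x * x) 1 (by ring)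
    rw [hg1] at h2
    rw [hfg x hx] at h1
    linarith
  let F : ℝ →+ ℝ := AddMonoidHom.mk' f hfadd
  have hsq : ∀ x, F (x * x) = F x * F x := by
    intro x
    rcases lt_trichotomy x 0 with hx | rfl | hx
    · have h1 : F (-x * -x) = F (-x) * F (-x) := hpos (-x) (by linarith)
      simpa using h1
    · simp
    · exact hpos x hx
  have hF : F.mkRingHomOfMulSelfOfTwoNeZero hsq two_ne_zero hf1 = RingHom.id ℝ :=
    Subsingleton.elim _ _
  have hft : f t = t := DFunLike.congr_fun hF t
  rw [hf, hft]

/-- A lightlike-preserving bijection fixing the origin is homogeneous. -/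
lemma map_smul (hφ : PreservesLightlike φ) (h0 : φ 0 = 0) (t : ℝ) (x : Fin 4 → ℝ) :
    φ (t • x) = t • φ x := by
  let G : AddSubgroup (Fin 4 → ℝ) :=
    { carrier := {x | φ (t • x) = t • φ x}
      zero_mem' := by simp [h0]
      add_mem' := by
        intro u v hu hv
        simp only [Set.mem_ofPred_eq] at hu hv ⊢
        rw [smul_add, hφ.map_add h0, hu, hv, hφ.map_add h0, smul_add]
      neg_mem' := by
        intro v hv
        simp only [Set.mem_ofPred_eq] at hv ⊢
        rw [smul_neg, hφ.map_neg h0, hv, hφ.map_neg h0, smul_neg] }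
  have hG : G = ⊤ := addSubgroup_eq_top_of_null_mem G (w := ![1, 0, 0, 1]) (by simp [mink])
    (fun hc => by simpa using congrFun hc 0)
    fun v hv _ => hφ.map_smul_null h0 hv t
  exact (hG ▸ AddSubgroup.mem_top x : x ∈ G)

lemma sub_const (hφ : PreservesLightlike φ) (a : Fin 4 → ℝ) :
    PreservesLightlike fun x => φ x - a where
  bijective := (Equiv.subRight a).bijective.comp hφ.bijective
  lightlike_iff x y := by
    rw [sub_sub_sub_cancel_right]
    exact hφ.lightlike_iff x y

end PreservesLightlike

lemma transpose_mul_minkM_mul_apply (A : Matrix (Fin 4) (Fin 4) ℝ) (i j : Fin 4) :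
    (Aᵀ * minkM * A) i j = mink (A *ᵥ Pi.single i 1) (A *ᵥ Pi.single j 1) := by
  simp [Matrix.mul_apply, Fin.sum_univ_four, minkM, mink, Matrix.diagonal_apply]
  ring

/-- A matrix preserving the null cone scales the Minkowski form. -/
lemma exists_transpose_mul_minkM_mul_eq_smul {A : Matrix (Fin 4) (Fin 4) ℝ}
    (hA : ∀ x, mink x x = 0 → mink (A *ᵥ x) (A *ᵥ x) = 0) :
    ∃ k : ℝ, Aᵀ * minkM * A = k • minkM := by
  let B : Fin 4 → Fin 4 → ℝ := fun i j => mink (A *ᵥ Pi.single i 1) (A *ᵥ Pi.single j 1)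
  have hB : ∀ i j, B i j = B j i := fun i j => mink_comm _ _
  have key : ∀ a b c d : ℝ, -(a * a) - b * b - c * c + d * d = 0 →
      a ^ 2 * B 0 0 + b ^ 2 * B 1 1 + c ^ 2 * B 2 2 + d ^ 2 * B 3 3 + 2 * (a * b * B 0 1 +
        a * c * B 0 2 + a * d * B 0 3 + b * c * B 1 2 + b * d * B 1 3 + c * d * B 2 3) = 0 := by
    intro a b c d h
    have h1 := hA (a • Pi.single 0 1 + b • Pi.single 1 1 + c • Pi.single 2 1 + d • Pi.single 3 1)
      (by simpa [mink, Pi.single_apply] using h)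
    simp only [Matrix.mulVec_add, Matrix.mulVec_smul, mink_add_left, mink_add_right,
      mink_smul_left, mink_smul_right] at h1
    linear_combination h1 + a * b * hB 0 1 + a * c * hB 0 2 + a * d * hB 0 3 + b * c * hB 1 2 +
      b * d * hB 1 3 + c * d * hB 2 3
  have h0p := key 1 0 0 1 (by norm_num)
  have h0m := key (-1) 0 0 1 (by norm_num)
  have h1p := key 0 1 0 1 (by norm_num)
  have h1m := key 0 (-1) 0 1 (by norm_num)
  have h2p := key 0 0 1 1 (by norm_num)
  have h2m := key 0 0 (-1) 1 (by norm_num)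
  have h01 := key 3 4 0 5 (by norm_num)
  have h02 := key 3 0 4 5 (by norm_num)
  have h12 := key 0 3 4 5 (by norm_num)
  refine ⟨B 3 3, ?_⟩
  ext i j
  rw [transpose_mul_minkM_mul_apply]
  change B i j = _
  wlog hij : i ≤ j generalizing i j
  · rw [hB, this j i (le_of_not_ge hij), Matrix.smul_apply, Matrix.smul_apply, minkM,
      ← Matrix.transpose_apply (Matrix.diagonal _), Matrix.diagonal_transpose]
  fin_cases i <;> fin_cases j <;> simp [minkM] at hij ⊢ <;> linarith

/-- By the signature of the Minkowski form, a similarity factor cannot be negative. -/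
lemma nonneg_of_transpose_mul_minkM_mul_eq_smul {A : Matrix (Fin 4) (Fin 4) ℝ} {k : ℝ}
    (hA : Aᵀ * minkM * A = k • minkM) : 0 ≤ k := by
  have hB : ∀ i j, mink (A *ᵥ Pi.single i 1) (A *ᵥ Pi.single j 1) = k * minkM i j := by
    intro i j
    rw [← transpose_mul_minkM_mul_apply, hA, Matrix.smul_apply, smul_eq_mul]
  have h00 := hB 0 0
  have h01 := hB 0 1
  have h11 := hB 1 1
  simp only [minkM, Matrix.diagonal_apply] at h00 h01 h11
  set p := A *ᵥ Pi.single (0 : Fin 4) (1 : ℝ)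
  set r := A *ᵥ Pi.single (1 : Fin 4) (1 : ℝ)
  have hneg : ∀ z : Fin 4 → ℝ, z 3 = 0 → mink z z ≤ 0 := by
    intro z hz
    simp only [mink, hz]
    nlinarith [sq_nonneg (z 0), sq_nonneg (z 1), sq_nonneg (z 2)]
  by_cases hp : p 3 = 0
  · have h1 := hneg p hp
    simp at h00
    linarith
  · have h1 := hneg (r 3 • p - p 3 • r) (by simp [mul_comm])
    simp only [mink_sub_left, mink_sub_right, mink_smul_left, mink_smul_right, mink_comm r p,
      h00, h01, h11] at h1
    simp at h1
    by_contra hk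
    have h2 : 0 < p 3 ^ 2 := by positivity
    nlinarith [sq_nonneg (r 3)]

/-- **Fundamental theorem of chronogeometry.**  A bijection of `ℝ⁴` preserving lightlikeness in
both directions is a composition of a Lorentz transformation, a positive scalar multiplication,
and a translation. -/
theorem fundamental_theorem_of_chronogeometry
    (φ : (Fin 4 → ℝ) → (Fin 4 → ℝ)) (hbij : Function.Bijective φ)
    (h : ∀ r₁ r₂ : Fin 4 → ℝ,
      mink (r₁ - r₂) (r₁ - r₂) = 0 ↔ mink (φ r₁ - φ r₂) (φ r₁ - φ r₂) = 0) :
    ∃ (c : ℝ) (Q : Matrix (Fin 4) (Fin 4) ℝ) (a : Fin 4 → ℝ),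
      0 < c ∧ IsLorentz Q ∧ ∀ r : Fin 4 → ℝ, φ r = c • Q.mulVec r + a := by
  have hφ : PreservesLightlike fun x => φ x - φ 0 := PreservesLightlike.sub_const ⟨hbij, h⟩ (φ 0)
  have h0 : φ 0 - φ 0 = 0 := sub_self _
  let L : (Fin 4 → ℝ) →ₗ[ℝ] (Fin 4 → ℝ) :=
    { toFun := fun x => φ x - φ 0
      map_add' := hφ.map_add h0
      map_smul' := hφ.map_smul h0 }
  let A := LinearMap.toMatrix' L
  have hA : ∀ x, A *ᵥ x = φ x - φ 0 := LinearMap.toMatrix'_mulVec L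
  have hnull : ∀ x, mink x x = 0 ↔ mink (A *ᵥ x) (A *ᵥ x) = 0 := by
    intro x
    rw [hA]
    exact hφ.null_iff_map h0 x
  obtain ⟨k, hk⟩ := exists_transpose_mul_minkM_mul_eq_smul fun x => (hnull x).1
  have hk0 : k ≠ 0 := by
    rintro rfl
    have h1 := transpose_mul_minkM_mul_apply A 3 3
    rw [hk, zero_smul, Matrix.zero_apply] at h1
    have h2 := (hnull _).2 h1.symm
    simp [mink] at h2
  have hkpos : 0 < k := (nonneg_of_transpose_mul_minkM_mul_eq_smul hk).lt_of_ne' hk0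
  have hsqrt : √k ≠ 0 := (Real.sqrt_pos.2 hkpos).ne'
  refine ⟨√k, (√k)⁻¹ • A, φ 0, Real.sqrt_pos.2 hkpos, ?_, fun r => ?_⟩
  · rw [IsLorentz, Matrix.transpose_smul, Matrix.smul_mul, Matrix.smul_mul, Matrix.mul_smul, hk,
      smul_smul, smul_smul, ← mul_inv, Real.mul_self_sqrt hkpos.le, inv_mul_cancel₀ hk0, one_smul]
  · rw [Matrix.smul_mulVec, smul_smul, mul_inv_cancel₀ hsqrt, one_smul, hA, sub_add_cancel]
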